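/- There exists a constant A ≥ 1 such that for all i ∈ Σ, all n ∈ ℕ and all a, b ∈ [0,1]², the diagonal Jacobian entries satisfy A⁻¹ ≤ |f_{i|n,x}(a)| / |f_{i|n,x}(b)| ≤ A and A⁻¹ ≤ |g_{i|n,y}(a)| / |g_{i|n,y}(b)| ≤ A. -/

import Mathlib

open MeasureTheory Filter Set

noncomputable section

namespace FFL

/-- The unit square `[0,1]² ⊆ ℝ²`. -/
def sq : Set (ℝ × ℝ) := Set.Icc (0:ℝ) 1 ×ˢ Set.Icc (0:ℝ) 1

/-- The Euclidean metric on `ℝ²`. -/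
def dE (a b : ℝ × ℝ) : ℝ := Real.sqrt ((a.1 - b.1) ^ 2 + (a.2 - b.2) ^ 2)

/-- Squared Frobenius norm of a 2×2 real matrix. -/
def frobSq (A : Matrix (Fin 2) (Fin 2) ℝ) : ℝ := ∑ i, ∑ j, (A i j) ^ 2

/-- The larger singular value `α₁` of a 2×2 real matrix, i.e. the larger positive square
root of the eigenvalues of `AᵀA`, via the standard closed formula. -/
def sv1 (A : Matrix (Fin 2) (Fin 2) ℝ) : ℝ :=
  Real.sqrt ((frobSq A + Real.sqrt ((frobSq A) ^ 2 - 4 * (A.det) ^ 2)) / 2)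

/-- The smaller singular value `α₂` of a 2×2 real matrix. -/
def sv2 (A : Matrix (Fin 2) (Fin 2) ℝ) : ℝ :=
  Real.sqrt ((frobSq A - Real.sqrt ((frobSq A) ^ 2 - 4 * (A.det) ^ 2)) / 2)

/-- The nonlinear, non-conformal iterated function systems of Falconer, Fraser and Lee:
maps `S i (a₁,a₂) = (f i a₁, g i (a₁,a₂))` on the unit square, where `f i`, `g i` are
`C^{1+α}` contractions (with partial derivatives `fx`, `gx`, `gy`) satisfying the
domination condition. -/
structure System (I : Type) [Fintype I] where
  f : I → ℝ → ℝ
  g : I → ℝ × ℝ → ℝ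
  fx : I → ℝ → ℝ
  gx : I → ℝ × ℝ → ℝ
  gy : I → ℝ × ℝ → ℝ
  /-- the index set has at least two elements -/
  card2 : 2 ≤ Fintype.card I
  /-- each `S i` maps the unit square into itself -/
  mapsTo : ∀ i, Set.MapsTo (fun a => (f i a.1, g i a)) sq sq
  /-- `fx i` is the derivative of `f i` on `[0,1]` -/
  hasDeriv_f : ∀ i, ∀ x ∈ Set.Icc (0:ℝ) 1,
    HasDerivWithinAt (f i) (fx i x) (Set.Icc (0:ℝ) 1) x
  /-- `(gx i, gy i)` is the (total) derivative of `g i` on the unit square -/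
  hasDeriv_g : ∀ i, ∀ a ∈ sq, HasFDerivWithinAt (g i)
      (gx i a • ContinuousLinearMap.fst ℝ ℝ ℝ + gy i a • ContinuousLinearMap.snd ℝ ℝ ℝ) sq a
  /-- the derivatives are `α`-Hölder for some `α > 0`, i.e. `f i`, `g i` are `C^{1+α}` -/
  holder : ∃ α > (0:ℝ), ∃ H > (0:ℝ), ∀ i,
      (∀ x ∈ Set.Icc (0:ℝ) 1, ∀ y ∈ Set.Icc (0:ℝ) 1, |fx i x - fx i y| ≤ H * |x - y| ^ α) ∧
      (∀ a ∈ sq, ∀ b ∈ sq, |gx i a - gx i b| ≤ H * dE a b ^ α) ∧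
      (∀ a ∈ sq, ∀ b ∈ sq, |gy i a - gy i b| ≤ H * dE a b ^ α)
  /-- the maps `f i`, `g i` (hence `S i`) are uniform contractions -/
  contracting : ∃ c, 0 ≤ c ∧ c < 1 ∧ ∀ i,
      (∀ x ∈ Set.Icc (0:ℝ) 1, ∀ y ∈ Set.Icc (0:ℝ) 1, |f i x - f i y| ≤ c * |x - y|) ∧
      (∀ a ∈ sq, ∀ b ∈ sq, |g i a - g i b| ≤ c * dE a b) ∧
      (∀ a ∈ sq, ∀ b ∈ sq, dE (f i a.1, g i a) (f i b.1, g i b) ≤ c * dE a b)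
  /-- the domination condition:
  `inf |f_{i,x}| > sup |g_{i,y}| ≥ inf |g_{i,y}| ≥ d > 0` -/
  domination : ∃ d > (0:ℝ), ∀ i,
      d ≤ sInf ((fun a => |gy i a|) '' sq) ∧
      sSup ((fun a => |gy i a|) '' sq) < sInf ((fun x => |fx i x|) '' Set.Icc (0:ℝ) 1)

variable {I : Type} [Fintype I]

/-- The map `S i`. -/
def S (T : System I) (i : I) (a : ℝ × ℝ) : ℝ × ℝ := (T.f i a.1, T.g i a)

/-- The composition `S_w = S_{i₁} ∘ ⋯ ∘ S_{i_n}` along a finite word `w = (i₁,…,i_n)`. -/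
def Sw (T : System I) : List I → ℝ × ℝ → ℝ × ℝ
  | [], a => a
  | i :: w, a => S T i (Sw T w a)

/-- The top-left entry `f_{w,x}(a)` of the (lower triangular) Jacobian `D_a S_w`,
via the chain rule. -/
def fxw (T : System I) : List I → ℝ × ℝ → ℝ
  | [], _ => 1
  | i :: w, a => T.fx i (Sw T w a).1 * fxw T w a

/-- The bottom-right entry `g_{w,y}(a)` of the Jacobian `D_a S_w`. -/
def gyw (T : System I) : List I → ℝ × ℝ → ℝ
  | [], _ => 1
  | i :: w, a => T.gy i (Sw T w a) * gyw T w a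

/-- The off-diagonal entry `g_{w,x}(a)` of the Jacobian `D_a S_w`. -/
def gxw (T : System I) : List I → ℝ × ℝ → ℝ
  | [], _ => 0
  | i :: w, a => T.gx i (Sw T w a) * fxw T w a + T.gy i (Sw T w a) * gxw T w a

/-- The Jacobian matrix `D_a S_w`. -/
def Dmat (T : System I) (w : List I) (a : ℝ × ℝ) : Matrix (Fin 2) (Fin 2) ℝ :=
  !![fxw T w a, 0; gxw T w a, gyw T w a]

/-- The larger singular value `α₁(D_a S_w)`. -/
def alpha1 (T : System I) (w : List I) (a : ℝ × ℝ) : ℝ := sv1 (Dmat T w a)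

/-- The smaller singular value `α₂(D_a S_w)`. -/
def alpha2 (T : System I) (w : List I) (a : ℝ × ℝ) : ℝ := sv2 (Dmat T w a)

/-- The restriction `i|n` of an infinite sequence to its first `n` symbols. -/
def word (ii : ℕ → I) (n : ℕ) : List I := List.ofFn (fun k : Fin n => ii k.1)

/-- The iterated left shift `σⁿ`. -/
def shiftn (ii : ℕ → I) (n : ℕ) : ℕ → I := fun k => ii (k + n)

/-- The left shift `σ` on `Σ = I^ℕ`. -/
def shift (ii : ℕ → I) : ℕ → I := fun k => ii (k + 1)

/-- The cylinder set `[w] ⊆ Σ` of a finite word `w`. -/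
def cyl (w : List I) : Set (ℕ → I) := {jj | ∀ k : Fin w.length, jj k.1 = w.get k}

/-- `F` is the attractor of the IFS: the (unique) nonempty compact subset of the unit
square with `F = ⋃ i, S i '' F`. -/
def IsAttractor (T : System I) (F : Set (ℝ × ℝ)) : Prop :=
  F.Nonempty ∧ IsCompact F ∧ F ⊆ sq ∧ F = ⋃ i, S T i '' F

/-- The strong separation condition: the sets `S i '' F` are pairwise disjoint. -/
def SSC (T : System I) (F : Set (ℝ × ℝ)) : Prop :=
  ∀ i j : I, i ≠ j → Disjoint (S T i '' F) (S T j '' F)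

/-- `Pi` is the canonical coding map `Π : Σ → [0,1]²`:
`Π(i)` is the unique point of `⋂ₙ S_{i|n}([0,1]²)`. -/
def IsCoding (T : System I) (Pi : (ℕ → I) → ℝ × ℝ) : Prop :=
  ∀ ii : ℕ → I, ∀ n : ℕ, Pi ii ∈ Sw T (word ii n) '' sq

/-- `m` is quasi-Bernoulli with constant `L`:
`L⁻¹ m[w] m[v] ≤ m[wv] ≤ L m[w] m[v]` for all finite words `w, v`. -/
def QuasiBernoulli [MeasurableSpace I] (m : Measure (ℕ → I)) (L : ℝ) : Prop :=
  0 < L ∧ ∀ w v : List I,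
    L⁻¹ * (m (cyl w)).toReal * (m (cyl v)).toReal ≤ (m (cyl (w ++ v))).toReal ∧
    (m (cyl (w ++ v))).toReal ≤ L * (m (cyl w)).toReal * (m (cyl v)).toReal

/-- The interval `Q₁(x,r) = [x - r/2, x + r/2]`. -/
def Q1 (x r : ℝ) : Set ℝ := Set.Icc (x - r / 2) (x + r / 2)

/-- The square `Q₂(a,r) = (a₁ - r/2, a₁ + r/2) × (a₂ - r/2, a₂ + r/2)`. -/
def Q2 (a : ℝ × ℝ) (r : ℝ) : Set (ℝ × ℝ) :=
  Set.Ioo (a.1 - r / 2) (a.1 + r / 2) ×ˢ Set.Ioo (a.2 - r / 2) (a.2 + r / 2)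

/-- The approximate square `B_n(a,r)`: points `b ∈ S_w([0,1]²)` with `|b₁ - a₁| ≤ r/2`. -/
def Bn (T : System I) (w : List I) (a : ℝ × ℝ) (r : ℝ) : Set (ℝ × ℝ) :=
  {b ∈ Sw T w '' sq | |b.1 - a.1| ≤ r / 2}

/-- The closed Euclidean ball in `ℝ²`. -/
def ballE (x : ℝ × ℝ) (r : ℝ) : Set (ℝ × ℝ) := {y | dE x y ≤ r}

/-- A measure on `ℝ` is exact dimensional with dimension `s` if for a.e. `x`,
`log ν(B(x,r)) / log r → s` as `r → 0⁺`. -/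
def ExactDim1 (ν : Measure ℝ) (s : ℝ) : Prop :=
  ∀ᵐ x ∂ν, Tendsto (fun r => Real.log (ν (Metric.closedBall x r)).toReal / Real.log r)
    (nhdsWithin 0 (Set.Ioi 0)) (nhds s)

/-- A measure on `ℝ²` is exact dimensional with dimension `s` (w.r.t. Euclidean balls). -/
def ExactDim2 (ν : Measure (ℝ × ℝ)) (s : ℝ) : Prop :=
  ∀ᵐ x ∂ν, Tendsto (fun r => Real.log (ν (ballE x r)).toReal / Real.log r)
    (nhdsWithin 0 (Set.Ioi 0)) (nhds s)

/-- `η = sup_{i ∈ I, a, b ∈ [0,1]²} |g_{i,y}(a)| / |f_{i,x}(b)|`. -/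
def eta (T : System I) : ℝ :=
  sSup {x : ℝ | ∃ i : I, ∃ a ∈ sq, ∃ b ∈ sq, x = |T.gy i a| / |T.fx i b.1|}

end FFL

open FFL

namespace FFL

theorem dE_nonneg (a b : ℝ × ℝ) : 0 ≤ dE a b := Real.sqrt_nonneg _

theorem abs_fst_sub_le_dE (a b : ℝ × ℝ) : |a.1 - b.1| ≤ dE a b :=
  Real.abs_le_sqrt (le_add_of_nonneg_right (sq_nonneg _))

theorem dE_le_two {a b : ℝ × ℝ} (ha : a ∈ sq) (hb : b ∈ sq) : dE a b ≤ 2 := by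
  obtain ⟨⟨ha1, ha2⟩, ha3, ha4⟩ := ha
  obtain ⟨⟨hb1, hb2⟩, hb3, hb4⟩ := hb
  refine Real.sqrt_le_iff.mpr ⟨by norm_num, ?_⟩
  nlinarith

variable {I : Type} [Fintype I]

theorem Sw_mem_sq (T : System I) (w : List I) {a : ℝ × ℝ} (ha : a ∈ sq) : Sw T w a ∈ sq := by
  induction w with
  | nil => exact ha
  | cons i w ih => exact T.mapsTo i ih

theorem dE_Sw_le (T : System I) {c : ℝ} (hc : 0 ≤ c)
    (hS : ∀ i, ∀ a ∈ sq, ∀ b ∈ sq, dE (S T i a) (S T i b) ≤ c * dE a b)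
    (w : List I) {a b : ℝ × ℝ} (ha : a ∈ sq) (hb : b ∈ sq) :
    dE (Sw T w a) (Sw T w b) ≤ c ^ w.length * dE a b := by
  induction w with
  | nil => simp [Sw]
  | cons i w ih =>
    calc dE (S T i (Sw T w a)) (S T i (Sw T w b))
        ≤ c * dE (Sw T w a) (Sw T w b) := hS i _ (Sw_mem_sq T w ha) _ (Sw_mem_sq T w hb)
      _ ≤ c * (c ^ w.length * dE a b) := by gcongr
      _ = c ^ (i :: w).length * dE a b := by rw [List.length_cons, pow_succ]; ring

/-- The diagonal entries of the Jacobians are uniformly bounded away from zero. -/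
theorem exists_pos_le_abs_diag (T : System I) :
    ∃ d > (0 : ℝ), ∀ i, (∀ a ∈ sq, d ≤ |T.gy i a|) ∧ ∀ a ∈ sq, d ≤ |T.fx i a.1| := by
  obtain ⟨d, hd, hdom⟩ := T.domination
  obtain ⟨α, hα, H, hH, hol⟩ := T.holder
  have hgy : ∀ i, ∀ a ∈ sq, d ≤ |T.gy i a| := fun i a ha =>
    (hdom i).1.trans (csInf_le ⟨0, by rintro _ ⟨b, -, rfl⟩; exact abs_nonneg _⟩ ⟨a, ha, rfl⟩)
  refine ⟨d, hd, fun i => ⟨hgy i, fun a ha => ?_⟩⟩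
  have hbdd : BddAbove ((fun b => |T.gy i b|) '' sq) := by
    refine ⟨|T.gy i a| + H * 2 ^ α, ?_⟩
    rintro _ ⟨b, hb, rfl⟩
    have h1 := (hol i).2.2 b hb a ha
    have h2 : H * dE b a ^ α ≤ H * 2 ^ α := by
      gcongr
      · exact dE_nonneg _ _
      · exact dE_le_two hb ha
    have h3 := abs_sub_abs_le_abs_sub (T.gy i b) (T.gy i a)
    change |T.gy i b| ≤ _
    linarith
  calc d ≤ |T.gy i a| := hgy i a ha
    _ ≤ sSup ((fun b => |T.gy i b|) '' sq) := le_csSup hbdd ⟨a, ha, rfl⟩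
    _ ≤ sInf ((fun x => |T.fx i x|) '' Set.Icc (0 : ℝ) 1) := (hdom i).2.le
    _ ≤ |T.fx i a.1| :=
      csInf_le ⟨0, by rintro _ ⟨b, -, rfl⟩; exact abs_nonneg _⟩ ⟨a.1, ha.1, rfl⟩

/-- Bounded distortion for a multiplicative cocycle over the system whose generators are Hölder
continuous and bounded away from zero. -/
theorem exists_distortion_bound (T : System I) {α H d : ℝ} (hα : 0 < α) (hH : 0 < H) (hd : 0 < d) :
    ∃ A : ℝ, 1 ≤ A ∧ ∀ (φ : I → ℝ × ℝ → ℝ) (u : List I → ℝ × ℝ → ℝ),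
      (∀ i, ∀ a ∈ sq, ∀ b ∈ sq, |φ i a - φ i b| ≤ H * dE a b ^ α) →
      (∀ i, ∀ a ∈ sq, d ≤ |φ i a|) →
      (∀ a, u [] a = 1) → (∀ i w a, u (i :: w) a = φ i (Sw T w a) * u w a) →
      ∀ w, ∀ a ∈ sq, ∀ b ∈ sq, A⁻¹ ≤ |u w a| / |u w b| ∧ |u w a| / |u w b| ≤ A := by
  obtain ⟨c, hc, hc1, hcon⟩ := T.contracting
  set r := c ^ α with hr
  have hr0 : 0 ≤ r := Real.rpow_nonneg hc _
  have hr1 : r < 1 := Real.rpow_lt_one hc hc1 hα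
  have h1r : 0 < 1 - r := sub_pos.mpr hr1
  set K := H * 2 ^ α / d with hK
  have hK0 : 0 ≤ K := by positivity
  refine ⟨Real.exp (K / (1 - r)), Real.one_le_exp (by positivity), ?_⟩
  intro φ u hφ hφd hu0 hu
  have hle : ∀ w, ∀ a ∈ sq, ∀ b ∈ sq,
      |u w a| ≤ Real.exp (K * (1 - r ^ w.length) / (1 - r)) * |u w b| := by
    intro w a ha b hb
    induction w with
    | nil => simp [hu0]
    | cons i w ih =>
      have ha' := Sw_mem_sq T w ha
      have hb' := Sw_mem_sq T w hb
      have hdist : dE (Sw T w a) (Sw T w b) ^ α ≤ r ^ w.length * 2 ^ α := by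
        have hcomm : r ^ w.length = (c ^ w.length) ^ α := by
          rw [hr, ← Real.rpow_mul_natCast hc, mul_comm, Real.rpow_natCast_mul hc]
        rw [hcomm, ← Real.mul_rpow (by positivity) (by norm_num)]
        refine Real.rpow_le_rpow (dE_nonneg _ _) ?_ hα.le
        refine (dE_Sw_le T hc (fun j => (hcon j).2.2) w ha hb).trans ?_
        gcongr
        exact dE_le_two ha hb
      have hgen : |φ i (Sw T w a)| ≤ Real.exp (K * r ^ w.length) * |φ i (Sw T w b)| := by
        have h1 := abs_sub_abs_le_abs_sub (φ i (Sw T w a)) (φ i (Sw T w b))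
        have h2 := hφ i _ ha' _ hb'
        have h3 : H * dE (Sw T w a) (Sw T w b) ^ α ≤ K * r ^ w.length * d := by
          calc _ ≤ H * (r ^ w.length * 2 ^ α) := by gcongr
            _ = _ := by rw [hK]; field_simp
        have h4 : K * r ^ w.length * d ≤ K * r ^ w.length * |φ i (Sw T w b)| := by
          gcongr
          exact hφd i _ hb'
        calc |φ i (Sw T w a)| ≤ (K * r ^ w.length + 1) * |φ i (Sw T w b)| := by linarith
          _ ≤ _ := by gcongr; exact Real.add_one_le_exp _
      rw [hu, hu, abs_mul, abs_mul]
      calc _ ≤ (Real.exp (K * r ^ w.length) * |φ i (Sw T w b)|) *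
            (Real.exp (K * (1 - r ^ w.length) / (1 - r)) * |u w b|) := by gcongr
        _ = Real.exp (K * r ^ w.length + K * (1 - r ^ w.length) / (1 - r)) *
            (|φ i (Sw T w b)| * |u w b|) := by rw [Real.exp_add]; ring
        _ = _ := by
          congr 2
          rw [List.length_cons, pow_succ]
          field_simp
          ring
  have hle' : ∀ w, ∀ a ∈ sq, ∀ b ∈ sq, |u w a| ≤ Real.exp (K / (1 - r)) * |u w b| := by
    intro w a ha b hb
    refine (hle w a ha b hb).trans ?_
    gcongr
    exact mul_le_of_le_one_right hK0 (sub_le_self _ (by positivity))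
  have hpos : ∀ w, ∀ a ∈ sq, 0 < |u w a| := by
    intro w a ha
    induction w with
    | nil => simp [hu0]
    | cons i w ih =>
      rw [hu, abs_mul]
      exact mul_pos (hd.trans_le (hφd i _ (Sw_mem_sq T w ha))) ih
  intro w a ha b hb
  refine ⟨?_, (div_le_iff₀ (hpos w b hb)).mpr (hle' w a ha b hb)⟩
  rw [le_div_iff₀ (hpos w b hb), inv_mul_le_iff₀ (Real.exp_pos _)]
  exact hle' w b hb a ha

end FFL

/-- bounded distortion for the diagonal Jacobian entries. -/
theorem stmt3 {I : Type} [Fintype I] (T : System I) :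
    ∃ A : ℝ, 1 ≤ A ∧ ∀ (ii : ℕ → I) (n : ℕ), ∀ a ∈ sq, ∀ b ∈ sq,
      (A⁻¹ ≤ |fxw T (word ii n) a| / |fxw T (word ii n) b| ∧
        |fxw T (word ii n) a| / |fxw T (word ii n) b| ≤ A) ∧
      (A⁻¹ ≤ |gyw T (word ii n) a| / |gyw T (word ii n) b| ∧
        |gyw T (word ii n) a| / |gyw T (word ii n) b| ≤ A) := by
  obtain ⟨d, hd, hdiag⟩ := exists_pos_le_abs_diag T
  obtain ⟨α, hα, H, hH, hol⟩ := T.holder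
  obtain ⟨A, hA, hdist⟩ := exists_distortion_bound T hα hH hd
  refine ⟨A, hA, fun ii n a ha b hb => ⟨?_, ?_⟩⟩
  · refine hdist (fun i a => T.fx i a.1) (fxw T) (fun i x hx y hy => ?_)
      (fun i => (hdiag i).2) (fun _ => rfl) (fun _ _ _ => rfl) _ a ha b hb
    refine ((hol i).1 x.1 hx.1 y.1 hy.1).trans ?_
    gcongr
    exact abs_fst_sub_le_dE x y
  · exact hdist T.gy (gyw T) (fun i => (hol i).2.2)
      (fun i => (hdiag i).1) (fun _ => rfl) (fun _ _ _ => rfl) _ a ha b hb
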